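/- For every graph cycle A ∈ C with A ≠ S, one has H_e(A) = max( min_{∂A} H − min_A H , 0 ). In particular, if A is moreover a non-trivial path cycle, then H_e(A) = min_{∂A} H − min_A H. -/

import Mathlib

open scoped ENNReal

namespace MetropolisCycles

variable {S : Type*} [Fintype S] [DecidableEq S]

/-- A path: a finite sequence of states whose consecutive members communicate. -/
def IsPath (q : S → S → ℝ) (ω : List S) : Prop :=
  ω.Chain' (fun a b => 0 < q a b)

/-- `x` and `y` are joined by a path entirely contained in `G`. -/
def JoinedIn (q : S → S → ℝ) (G : Set S) (x y : S) : Prop :=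
  ∃ ω : List S, ω.head? = some x ∧ ω.getLast? = some y ∧ IsPath q ω ∧ ∀ z ∈ ω, z ∈ G

/-- `G` is connected: any two of its points are joined by a path inside `G`. -/
def IsConnectedSet (q : S → S → ℝ) (G : Set S) : Prop :=
  ∀ x ∈ G, ∀ y ∈ G, JoinedIn q G x y

/-- The exterior boundary `∂G`. -/
def extBoundary (q : S → S → ℝ) (G : Set S) : Set S :=
  {y | y ∉ G ∧ ∃ x ∈ G, 0 < q x y}

/-- `A` is a non-trivial path cycle: connected and `max_A H < min_{∂A} H`. -/
def IsNontrivialPathCycle (H : S → ℝ) (q : S → S → ℝ) (A : Set S) : Prop :=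
  A.Nonempty ∧ IsConnectedSet q A ∧ ∀ x ∈ A, ∀ y ∈ extBoundary q A, H x < H y

/-- `A` is a path cycle: a singleton or a non-trivial path cycle. -/
def IsPathCycle (H : S → ℝ) (q : S → S → ℝ) (A : Set S) : Prop :=
  (∃ x, A = {x}) ∨ IsNontrivialPathCycle H q A

/-- The set of points joined to `x` by a path whose points all have energy at most `c`. -/
def energyCut (H : S → ℝ) (q : S → S → ℝ) (c : ℝ) (x : S) : Set S :=
  {y | JoinedIn q {z | H z ≤ c} x y}

/-- `U_{≤ x}`: the points joined to `x` by a path with energies at most `H x`. -/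
def Ule (H : S → ℝ) (q : S → S → ℝ) (x : S) : Set S := energyCut H q (H x) x

/-- The total cost of a path of cycles with respect to a cost function `Vs`. -/
noncomputable def listCost (Vs : Set S → Set S → ℝ≥0∞) : List (Set S) → ℝ≥0∞
  | [] => 0
  | [_] => 0
  | B :: B' :: l => Vs B B' + listCost Vs (B' :: l)

/-- `H_e` relative to a level `(E, V)` of the construction:
`H_e(A) = min { V(A,A') : A' ∈ E, A' ≠ A }`. -/
noncomputable def HeAux (E : Set (Set S)) (V : Set S → Set S → ℝ≥0∞) (A : Set S) : ℝ≥0∞ :=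
  ⨅ A' ∈ E \ {A}, V A A'

/-- The renormalized cost function `V_* (A,B) = V(A,B) - H_e(A)`. -/
noncomputable def VsAux (E : Set (Set S)) (V : Set S → Set S → ℝ≥0∞) (A B : Set S) : ℝ≥0∞ :=
  V A B - HeAux E V A

/-- `A →_k A'`: some path of elements of `E` from `A` to `A'` has zero total `V_*`-cost. -/
def arrowAux (E : Set (Set S)) (V : Set S → Set S → ℝ≥0∞) (A A' : Set S) : Prop :=
  ∃ l : List (Set S), l.head? = some A ∧ l.getLast? = some A' ∧ (∀ B ∈ l, B ∈ E) ∧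
    listCost (VsAux E V) l = 0

/-- The set `D^{k+1}`: unions of the `R_k`-equivalence classes. -/
def DAux (E : Set (Set S)) (V : Set S → Set S → ℝ≥0∞) : Set (Set S) :=
  {B | ∃ A ∈ E, B = ⋃₀ {A' | A' ∈ E ∧ arrowAux E V A A' ∧ arrowAux E V A' A}}

/-- The order relation `≥^{k+1}` on `D^{k+1}`. -/
def geqAux (E : Set (Set S)) (V : Set S → Set S → ℝ≥0∞) (B B' : Set S) : Prop :=
  ∃ C ∈ E, ∃ C' ∈ E, C ⊆ B ∧ C' ⊆ B' ∧ arrowAux E V C C'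

/-- `D_*^{k+1}`: the minimal elements of `D^{k+1}` for `≥^{k+1}`. -/
def DstarAux (E : Set (Set S)) (V : Set S → Set S → ℝ≥0∞) : Set (Set S) :=
  {B ∈ DAux E V | ∀ B' ∈ DAux E V, geqAux E V B B' → B' = B}

/-- `E^{k+1}` built from `(E^k, V^k)`. -/
def EnextAux (E : Set (Set S)) (V : Set S → Set S → ℝ≥0∞) : Set (Set S) :=
  DstarAux E V ∪ {A | A ∈ E ∧ ∃ B ∈ DAux E V \ DstarAux E V, A ⊆ B}

/-- `H_m^{k+1}(A) = max { H_e^k(A') : A' ∈ E^k, A' ⊆ A }`. -/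
noncomputable def HmAux (E : Set (Set S)) (V : Set S → Set S → ℝ≥0∞) (A : Set S) : ℝ≥0∞ :=
  ⨆ A' ∈ {A' | A' ∈ E ∧ A' ⊆ A}, HeAux E V A'

/-- `V^{k+1}(A,A') = H_m^{k+1}(A) + min { V_*^k(B,B') : B,B' ∈ E^k, B ⊆ A, B' ⊆ A' }`. -/
noncomputable def VnextAux (E : Set (Set S)) (V : Set S → Set S → ℝ≥0∞) (A A' : Set S) : ℝ≥0∞ :=
  HmAux E V A + ⨅ B ∈ {B | B ∈ E ∧ B ⊆ A}, ⨅ B' ∈ {B' | B' ∈ E ∧ B' ⊆ A'}, VsAux E V B B'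

/-- The zero-order cost function `V^0({i},{j}) = (H j - H i)⁺` if `q i j > 0`, `∞` otherwise
(and `∞` on non-singletons). -/
noncomputable def V0 (H : S → ℝ) (q : S → S → ℝ) (A B : Set S) : ℝ≥0∞ :=
  ⨅ i ∈ A, ⨅ j ∈ B, ⨅ _ : A = {i} ∧ B = {j} ∧ 0 < q i j, ENNReal.ofReal (H j - H i)

/-- The recursive construction `k ↦ (E^k, V^k)`. -/
noncomputable def cycEV (H : S → ℝ) (q : S → S → ℝ) : ℕ → Set (Set S) × (Set S → Set S → ℝ≥0∞)
  | 0 => ({A | ∃ i, A = {i}}, V0 H q)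
  | k + 1 => (EnextAux (cycEV H q k).1 (cycEV H q k).2,
              VnextAux (cycEV H q k).1 (cycEV H q k).2)

/-- The `k`-th order set of graph cycles `E^k`. -/
noncomputable def Ecyc (H : S → ℝ) (q : S → S → ℝ) (k : ℕ) : Set (Set S) := (cycEV H q k).1

/-- The `k`-th order cost function `V^k`. -/
noncomputable def Vcyc (H : S → ℝ) (q : S → S → ℝ) (k : ℕ) : Set S → Set S → ℝ≥0∞ :=
  (cycEV H q k).2

/-- `H_e^k(A)`. -/
noncomputable def Hek (H : S → ℝ) (q : S → S → ℝ) (k : ℕ) (A : Set S) : ℝ≥0∞ :=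
  HeAux (Ecyc H q k) (Vcyc H q k) A

/-- `H_m^k(A)` (defined for `k ≥ 1`; set to `0` at `k = 0`). -/
noncomputable def Hmk (H : S → ℝ) (q : S → S → ℝ) : ℕ → Set S → ℝ≥0∞
  | 0 => fun _ => 0
  | k + 1 => fun A => HmAux (Ecyc H q k) (Vcyc H q k) A

/-- `D^{n+1}` (indexed by `n`). -/
noncomputable def Dcyc (H : S → ℝ) (q : S → S → ℝ) (n : ℕ) : Set (Set S) :=
  DAux (Ecyc H q n) (Vcyc H q n)

/-- `D_*^{n+1}` (indexed by `n`). -/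
noncomputable def DstarCyc (H : S → ℝ) (q : S → S → ℝ) (n : ℕ) : Set (Set S) :=
  DstarAux (Ecyc H q n) (Vcyc H q n)

/-- The set of graph cycles `C = ∪_k E^k`. -/
def GraphCycles (H : S → ℝ) (q : S → S → ℝ) : Set (Set S) := {A | ∃ k, A ∈ Ecyc H q k}

/-- `H_e(A) = sup { H_e^k(A) : k ≥ 0, A ∈ E^k }` (for a graph cycle `A ≠ S`). -/
noncomputable def HeC (H : S → ℝ) (q : S → S → ℝ) (A : Set S) : ℝ≥0∞ :=
  ⨆ k, ⨆ _ : A ∈ Ecyc H q k, Hek H q k A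

/-- `H_m(A) = max( sup { H_e(B) : B ∈ C, B ⊆ A, B ≠ A }, 0 )` (for `|A| > 1`). -/
noncomputable def HmC (H : S → ℝ) (q : S → S → ℝ) (A : Set S) : ℝ≥0∞ :=
  ⨆ B ∈ {B | B ∈ GraphCycles H q ∧ B ⊆ A ∧ B ≠ A}, HeC H q B

section

variable {X : Type*}

lemma iInf_tsub_const {ι : Sort*} (f : ι → ℝ≥0∞) {a : ℝ≥0∞} (ha : a ≠ ⊤) :
    (⨅ i, f i) - a = ⨅ i, (f i - a) :=
  Monotone.map_iInf_of_continuousAt (f := fun x => x - a)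
    (ENNReal.continuous_sub_right a).continuousAt (fun _ _ h => tsub_le_tsub_right h a)
    (ENNReal.top_sub ha)

/-- The lowest value of `max (K x) (K y)` along an edge from `A` to `B`. -/
noncomputable def saddle (K : X → ℝ≥0∞) (q : X → X → ℝ) (A B : Set X) : ℝ≥0∞ :=
  ⨅ x ∈ A, ⨅ y ∈ B, ⨅ _ : 0 < q x y, max (K x) (K y)

/-- The lowest value of `K` on `A`. -/
noncomputable def bottom (K : X → ℝ≥0∞) (A : Set X) : ℝ≥0∞ := ⨅ x ∈ A, K x

lemma le_saddle_iff {K : X → ℝ≥0∞} {q : X → X → ℝ} {A B : Set X} {c : ℝ≥0∞} :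
    c ≤ saddle K q A B ↔ ∀ x ∈ A, ∀ y ∈ B, 0 < q x y → c ≤ max (K x) (K y) := by
  simp only [saddle, le_iInf_iff]

lemma saddle_le {K : X → ℝ≥0∞} {q : X → X → ℝ} {A B : Set X} {x y : X}
    (hx : x ∈ A) (hy : y ∈ B) (hxy : 0 < q x y) : saddle K q A B ≤ max (K x) (K y) :=
  le_saddle_iff.1 le_rfl x hx y hy hxy

lemma saddle_anti {K : X → ℝ≥0∞} {q : X → X → ℝ} {A A' B B' : Set X} (hA : A' ⊆ A)
    (hB : B' ⊆ B) : saddle K q A B ≤ saddle K q A' B' :=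
  le_saddle_iff.2 fun _ hx _ hy hxy => saddle_le (hA hx) (hB hy) hxy

lemma saddle_comm {q : X → X → ℝ} (hsym : ∀ x y, q x y = q y x) (K : X → ℝ≥0∞) (A B : Set X) :
    saddle K q A B = saddle K q B A := by
  apply le_antisymm <;> refine le_saddle_iff.2 fun x hx y hy hxy => ?_ <;>
    rw [max_comm] <;> exact saddle_le hy hx (hsym x y ▸ hxy)

lemma bottom_le {K : X → ℝ≥0∞} {A : Set X} {x : X} (hx : x ∈ A) : bottom K A ≤ K x :=
  iInf₂_le x hx

lemma bottom_anti {K : X → ℝ≥0∞} {A B : Set X} (hBA : B ⊆ A) : bottom K A ≤ bottom K B :=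
  le_iInf₂ fun _ hx => bottom_le (hBA hx)

lemma bottom_le_saddle (K : X → ℝ≥0∞) (q : X → X → ℝ) (A B : Set X) :
    bottom K A ≤ saddle K q A B :=
  le_saddle_iff.2 fun _ hx _ _ _ => (bottom_le hx).trans (le_max_left _ _)

lemma bottom_ne_top {K : X → ℝ≥0∞} (hK : ∀ x, K x ≠ ⊤) {A : Set X} (hA : A.Nonempty) :
    bottom K A ≠ ⊤ := by
  obtain ⟨x, hx⟩ := hA
  exact ne_top_of_le_ne_top (hK x) (bottom_le hx)

lemma arrowAux_iff {E : Set (Set X)} {V : Set X → Set X → ℝ≥0∞} {A A' : Set X} (hA : A ∈ E) :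
    arrowAux E V A A' ↔
      Relation.ReflTransGen (fun B B' => B ∈ E ∧ B' ∈ E ∧ VsAux E V B B' = 0) A A' := by
  constructor
  · rintro ⟨l, h1, h2, h3, h4⟩
    clear hA
    induction l generalizing A with
    | nil => simp at h1
    | cons B l ih =>
      obtain rfl : B = A := by simpa using h1
      cases l with
      | nil =>
        obtain rfl : B = A' := by simpa using h2
        exact .refl
      | cons B' l =>
        simp only [listCost, add_eq_zero] at h4
        exact .head ⟨h3 B (by simp), h3 B' (by simp), h4.1⟩
          (ih rfl (by simpa using h2) (fun C hC => h3 C (List.mem_cons_of_mem _ hC)) h4.2)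
  · intro h
    induction h using Relation.ReflTransGen.head_induction_on with
    | refl => exact ⟨[A'], rfl, rfl, by simpa using hA, rfl⟩
    | head hB _ ih =>
      rename_i B B' _
      obtain ⟨l, h1, h2, h3, h4⟩ := ih hB.2.1
      cases l with
      | nil => simp at h1
      | cons C l =>
        obtain rfl : C = B' := by simpa using h1
        refine ⟨B :: C :: l, rfl, by simpa using h2, ?_, by simp [listCost, hB.2.2, h4]⟩
        intro D hD
        rcases List.mem_cons.1 hD with rfl | hD
        exacts [hA, h3 D hD]

lemma arrowAux.trans {E : Set (Set X)} {V : Set X → Set X → ℝ≥0∞} {A B C : Set X} (hA : A ∈ E)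
    (hB : B ∈ E) (h : arrowAux E V A B) (h' : arrowAux E V B C) : arrowAux E V A C :=
  (arrowAux_iff hA).2 (((arrowAux_iff hA).1 h).trans ((arrowAux_iff hB).1 h'))

lemma arrowAux.refl {E : Set (Set X)} (V : Set X → Set X → ℝ≥0∞) {A : Set X} (hA : A ∈ E) :
    arrowAux E V A A :=
  (arrowAux_iff hA).2 .refl

/-- The union of the class of `A` for mutual zero-cost reachability. -/
def arrowClass (E : Set (Set X)) (V : Set X → Set X → ℝ≥0∞) (A : Set X) : Set X :=
  ⋃₀ {A' | A' ∈ E ∧ arrowAux E V A A' ∧ arrowAux E V A' A}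

lemma subset_arrowClass {E : Set (Set X)} {V : Set X → Set X → ℝ≥0∞} {A B : Set X} (hB : B ∈ E)
    (h : arrowAux E V A B) (h' : arrowAux E V B A) : B ⊆ arrowClass E V A :=
  Set.subset_sUnion_of_mem ⟨hB, h, h'⟩

lemma arrowClass_congr {E : Set (Set X)} {V : Set X → Set X → ℝ≥0∞} {A B : Set X} (hA : A ∈ E)
    (hB : B ∈ E) (h : arrowAux E V A B) (h' : arrowAux E V B A) :
    arrowClass E V A = arrowClass E V B := by
  apply Set.Subset.antisymm <;> refine Set.sUnion_subset fun C hC => ?_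
  · exact subset_arrowClass hC.1 (h'.trans hB hA hC.2.1) (hC.2.2.trans hC.1 hA h)
  · exact subset_arrowClass hC.1 (h.trans hA hB hC.2.1) (hC.2.2.trans hC.1 hB h')

lemma arrowClass_mem_DAux {E : Set (Set X)} (V : Set X → Set X → ℝ≥0∞) {A : Set X} (hA : A ∈ E) :
    arrowClass E V A ∈ DAux E V :=
  ⟨A, hA, rfl⟩

lemma exists_mem_subset {E : Set (Set X)} {V : Set X → Set X → ℝ≥0∞} {A : Set X}
    (hA : A ∈ EnextAux E V) {x : X} (hx : x ∈ A) : ∃ B ∈ E, B ⊆ A ∧ x ∈ B := by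
  rcases hA with ⟨⟨A, hA, rfl⟩, -⟩ | ⟨hA, -⟩
  · obtain ⟨B, hB, hxB⟩ := hx
    exact ⟨B, hB.1, Set.subset_sUnion_of_mem hB, hxB⟩
  · exact ⟨A, hA, subset_rfl, hx⟩

/-- The properties shared by all levels `(E, V)` of the construction: `E` is a partition into
nonempty sets, the cost between distinct members is the saddle height above the bottom, and the
points of a non-singleton member lie strictly below its exterior boundary. -/
structure IsCycleLevel (K : X → ℝ≥0∞) (q : X → X → ℝ) (E : Set (Set X))
    (V : Set X → Set X → ℝ≥0∞) : Prop where
  nonempty : ∀ A ∈ E, A.Nonempty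
  cover : ∀ x, ∃ A ∈ E, x ∈ A
  eq_of_mem : ∀ A ∈ E, ∀ B ∈ E, ∀ x ∈ A, x ∈ B → A = B
  cost : ∀ A ∈ E, ∀ B ∈ E, A ≠ B → V A B = saddle K q A B - bottom K A
  lt_boundary : ∀ A ∈ E, (∃ x, A = {x}) ∨
    ∀ x ∈ A, ∀ y ∉ A, 0 < q x y → ∀ z ∈ A, K z < K y

namespace IsCycleLevel

variable {K : X → ℝ≥0∞} {q : X → X → ℝ} {E : Set (Set X)} {V : Set X → Set X → ℝ≥0∞}
  {A B C : Set X}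

lemma subset_compl (h : IsCycleLevel K q E V) (hA : A ∈ E) (hB : B ∈ E) (hAB : A ≠ B) :
    B ⊆ Aᶜ :=
  fun x hxB hxA => hAB (h.eq_of_mem A hA B hB x hxA hxB)

lemma HeAux_eq (h : IsCycleLevel K q E V) (hK : ∀ x, K x ≠ ⊤) (hA : A ∈ E) :
    HeAux E V A = saddle K q A Aᶜ - bottom K A := by
  have hb := bottom_ne_top hK (h.nonempty A hA)
  have h1 : HeAux E V A = (⨅ A' ∈ E \ {A}, saddle K q A A') - bottom K A := by
    simp only [HeAux, iInf_tsub_const _ hb]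
    exact iInf_congr fun A' => iInf_congr fun hA' => h.cost A hA A' hA'.1 (Ne.symm hA'.2)
  rw [h1]
  congr 1
  apply le_antisymm
  · refine le_saddle_iff.2 fun x hx y hy hxy => ?_
    obtain ⟨B, hB, hyB⟩ := h.cover y
    exact (iInf₂_le B ⟨hB, by rintro rfl; exact hy hyB⟩).trans (saddle_le hx hyB hxy)
  · exact le_iInf₂ fun B hB =>
      saddle_anti subset_rfl (h.subset_compl hA hB.1 (Ne.symm hB.2))

lemma VsAux_eq (h : IsCycleLevel K q E V) (hK : ∀ x, K x ≠ ⊤) (hA : A ∈ E) (hB : B ∈ E)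
    (hAB : A ≠ B) : VsAux E V A B = saddle K q A B - saddle K q A Aᶜ := by
  rw [VsAux, h.cost A hA B hB hAB, h.HeAux_eq hK hA, tsub_tsub,
    add_tsub_cancel_of_le (bottom_le_saddle K q A Aᶜ)]

lemma saddle_compl_le (h : IsCycleLevel K q E V) (hK : ∀ x, K x ≠ ⊤)
    (hsym : ∀ x y, q x y = q y x) (hA : A ∈ E) (hAB : arrowAux E V A B) :
    saddle K q B Bᶜ ≤ saddle K q A Aᶜ := by
  induction (arrowAux_iff hA).1 hAB with
  | refl => exact le_rfl
  | tail h1 h2 ih =>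
    rename_i B C
    obtain ⟨hB, hC, h0⟩ := h2
    refine le_trans ?_ (ih ((arrowAux_iff hA).2 h1))
    rcases eq_or_ne B C with rfl | hBC
    · exact le_rfl
    rw [h.VsAux_eq hK hB hC hBC, tsub_eq_zero_iff_le] at h0
    refine le_trans ?_ h0
    rw [saddle_comm hsym K B C]
    exact saddle_anti (Set.Subset.refl C) (h.subset_compl hC hB hBC.symm)

lemma of_subset_arrowClass (h : IsCycleLevel K q E V) (hB : B ∈ E)
    (hBA : B ⊆ arrowClass E V A) : arrowAux E V A B ∧ arrowAux E V B A := by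
  obtain ⟨x, hx⟩ := h.nonempty B hB
  obtain ⟨C, hC, hxC⟩ := hBA hx
  obtain rfl := h.eq_of_mem B hB C hC.1 x hx hxC
  exact hC.2

lemma DAux_eq_of_mem (h : IsCycleLevel K q E V) (hA : A ∈ DAux E V) (hB : B ∈ DAux E V) {x : X}
    (hxA : x ∈ A) (hxB : x ∈ B) : A = B := by
  obtain ⟨A, hA, rfl⟩ := hA
  obtain ⟨B, hB, rfl⟩ := hB
  obtain ⟨C, ⟨hC, h1, h2⟩, hxC⟩ := hxA
  obtain ⟨D, ⟨hD, h3, h4⟩, hxD⟩ := hxB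
  obtain rfl := h.eq_of_mem C hC D hD x hxC hxD
  exact (arrowClass_congr hA hC h1 h2).trans (arrowClass_congr hB hC h3 h4).symm

lemma exists_saddle_compl_eq (h : IsCycleLevel K q E V) (hK : ∀ x, K x ≠ ⊤)
    (hsym : ∀ x y, q x y = q y x) (hA : A ∈ EnextAux E V) :
    ∃ w, ∀ B ∈ E, B ⊆ A → saddle K q B Bᶜ = w := by
  rcases hA with ⟨⟨A, hA, rfl⟩, -⟩ | ⟨hA, -⟩
  · refine ⟨saddle K q A Aᶜ, fun B hB hBA => ?_⟩
    obtain ⟨h1, h2⟩ := h.of_subset_arrowClass hB hBA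
    exact le_antisymm (h.saddle_compl_le hK hsym hA h1) (h.saddle_compl_le hK hsym hB h2)
  · refine ⟨saddle K q A Aᶜ, fun B hB hBA => ?_⟩
    obtain ⟨x, hx⟩ := h.nonempty B hB
    rw [h.eq_of_mem B hB A hA x hx (hBA hx)]

lemma EnextAux_nonempty (h : IsCycleLevel K q E V) (hA : A ∈ EnextAux E V) : A.Nonempty := by
  rcases hA with ⟨⟨A, hA, rfl⟩, -⟩ | ⟨hA, -⟩
  · exact (h.nonempty A hA).mono (subset_arrowClass hA (.refl V hA) (.refl V hA))
  · exact h.nonempty A hA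

lemma EnextAux_cover (h : IsCycleLevel K q E V) (x : X) : ∃ A ∈ EnextAux E V, x ∈ A := by
  obtain ⟨B, hB, hx⟩ := h.cover x
  have hsub := subset_arrowClass hB (.refl V hB) (.refl V hB)
  by_cases hs : arrowClass E V B ∈ DstarAux E V
  · exact ⟨_, .inl hs, hsub hx⟩
  · exact ⟨B, .inr ⟨hB, _, ⟨arrowClass_mem_DAux V hB, hs⟩, hsub⟩, hx⟩

lemma EnextAux_eq_of_mem (h : IsCycleLevel K q E V) (hA : A ∈ EnextAux E V)
    (hB : B ∈ EnextAux E V) {x : X} (hxA : x ∈ A) (hxB : x ∈ B) : A = B := by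
  rcases hA with hA | ⟨hA, D, hD, hAD⟩ <;> rcases hB with hB | ⟨hB, D', hD', hBD⟩
  · exact h.DAux_eq_of_mem hA.1 hB.1 hxA hxB
  · exact absurd (h.DAux_eq_of_mem hA.1 hD'.1 hxA (hBD hxB) ▸ hA) hD'.2
  · exact absurd (h.DAux_eq_of_mem hB.1 hD.1 hxB (hAD hxA) ▸ hB) hD.2
  · exact h.eq_of_mem A hA B hB x hxA hxB

lemma HmAux_eq (h : IsCycleLevel K q E V) (hK : ∀ x, K x ≠ ⊤) (hA : A ∈ EnextAux E V)
    {w : ℝ≥0∞} (hw : ∀ B ∈ E, B ⊆ A → saddle K q B Bᶜ = w) :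
    HmAux E V A = w - bottom K A := by
  have hb : bottom K A = ⨅ B ∈ {B | B ∈ E ∧ B ⊆ A}, bottom K B := by
    apply le_antisymm
    · exact le_iInf₂ fun B hB => bottom_anti hB.2
    · refine le_iInf₂ fun x hx => ?_
      obtain ⟨B, hB, hBA, hxB⟩ := exists_mem_subset hA hx
      exact (iInf₂_le B ⟨hB, hBA⟩).trans (bottom_le hxB)
  simp only [hb, HmAux, ENNReal.sub_iInf]
  exact iSup_congr fun B => iSup_congr fun hB => by rw [h.HeAux_eq hK hB.1, hw B hB.1 hB.2]

lemma VnextAux_eq (h : IsCycleLevel K q E V) (hK : ∀ x, K x ≠ ⊤)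
    (hsym : ∀ x y, q x y = q y x) (hA : A ∈ EnextAux E V) (hB : B ∈ EnextAux E V)
    (hAB : A ≠ B) : VnextAux E V A B = saddle K q A B - bottom K A := by
  obtain ⟨w, hw⟩ := h.exists_saddle_compl_eq hK hsym hA
  have hne : ∀ C ∈ E, C ⊆ A → ∀ D ∈ E, D ⊆ B → C ≠ D := by
    rintro C hC hCA _ - hDB rfl
    obtain ⟨x, hx⟩ := h.nonempty C hC
    exact hAB (h.EnextAux_eq_of_mem hA hB (hCA hx) (hDB hx))
  have hbA := bottom_ne_top hK (h.EnextAux_nonempty hA)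
  have hs : saddle K q A B =
      ⨅ C ∈ {C | C ∈ E ∧ C ⊆ A}, ⨅ D ∈ {D | D ∈ E ∧ D ⊆ B}, saddle K q C D := by
    apply le_antisymm
    · exact le_iInf₂ fun C hC => le_iInf₂ fun D hD => saddle_anti hC.2 hD.2
    · refine le_saddle_iff.2 fun x hx y hy hxy => ?_
      obtain ⟨C, hC, hCA, hxC⟩ := exists_mem_subset hA hx
      obtain ⟨D, hD, hDB, hyD⟩ := exists_mem_subset hB hy
      exact (iInf₂_le C ⟨hC, hCA⟩).trans ((iInf₂_le D ⟨hD, hDB⟩).trans (saddle_le hxC hyD hxy))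
  have hle : w ≤ saddle K q A B := by
    rw [hs]
    refine le_iInf₂ fun C hC => le_iInf₂ fun D hD => ?_
    rw [← hw C hC.1 hC.2]
    exact saddle_anti subset_rfl (h.subset_compl hC.1 hD.1 (hne C hC.1 hC.2 D hD.1 hD.2))
  rw [VnextAux, h.HmAux_eq hK hA hw]
  rcases eq_or_ne w ⊤ with rfl | hwt
  · rw [ENNReal.top_sub hbA, top_le_iff.1 hle, ENNReal.top_sub hbA, top_add]
  have hbw : bottom K A ≤ w := by
    obtain ⟨x, hx⟩ := h.EnextAux_nonempty hA
    obtain ⟨C, hC, hCA, -⟩ := exists_mem_subset hA hx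
    rw [← hw C hC hCA]
    exact (bottom_anti hCA).trans (bottom_le_saddle K q C Cᶜ)
  have hV : (⨅ C ∈ {C | C ∈ E ∧ C ⊆ A}, ⨅ D ∈ {D | D ∈ E ∧ D ⊆ B}, VsAux E V C D) =
      saddle K q A B - w := by
    simp only [hs, iInf_tsub_const _ hwt]
    refine iInf_congr fun C => iInf_congr fun hC => iInf_congr fun D => iInf_congr fun hD => ?_
    rw [h.VsAux_eq hK hC.1 hD.1 (hne C hC.1 hC.2 D hD.1 hD.2), hw C hC.1 hC.2]
  rw [hV, add_comm, tsub_add_tsub_cancel hle hbw]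

lemma le_saddle_compl (h : IsCycleLevel K q E V) (hA : A ∈ E) {x : X} (hx : x ∈ A) :
    K x ≤ saddle K q A Aᶜ := by
  refine le_saddle_iff.2 fun u hu v hv huv => ?_
  rcases h.lt_boundary A hA with ⟨z, rfl⟩ | hlt
  · rw [Set.mem_singleton_iff] at hx hu
    rw [hx, hu]
    exact le_max_left _ _
  · exact (hlt u hu v hv huv x hx).le.trans (le_max_right _ _)

lemma lt_of_mem_DstarAux (h : IsCycleLevel K q E V) (hK : ∀ x, K x ≠ ⊤)
    (hsym : ∀ x y, q x y = q y x) (hA : A ∈ DstarAux E V) {x y z : X} (hx : x ∈ A) (hy : y ∉ A)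
    (hxy : 0 < q x y) (hz : z ∈ A) : K z < K y := by
  have hA' : A ∈ EnextAux E V := .inl hA
  obtain ⟨w, hw⟩ := h.exists_saddle_compl_eq hK hsym hA'
  have hKw : ∀ u ∈ A, K u ≤ w := by
    intro u hu
    obtain ⟨B, hB, hBA, huB⟩ := exists_mem_subset hA' hu
    exact hw B hB hBA ▸ h.le_saddle_compl hB huB
  obtain ⟨B, hB, hBA, hxB⟩ := exists_mem_subset hA' hx
  obtain ⟨C, hC, hyC⟩ := h.cover y
  have hBC : B ≠ C := by rintro rfl; exact hy (hBA hyC)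
  have hw' : w < saddle K q B C := by
    by_contra! hle
    refine hy ?_
    have h0 : VsAux E V B C = 0 := by
      rw [h.VsAux_eq hK hB hC hBC, tsub_eq_zero_iff_le, hw B hB hBA]
      exact hle
    have hCc := subset_arrowClass hC (.refl V hC) (.refl V hC)
    rw [← hA.2 _ (arrowClass_mem_DAux V hC)
      ⟨B, hB, C, hC, hBA, hCc, (arrowAux_iff hB).2 (.single ⟨hB, hC, h0⟩)⟩]
    exact hCc hyC
  rcases lt_max_iff.1 (hw'.trans_le (saddle_le hxB hyC hxy)) with h1 | h1
  · exact absurd (hKw x hx) h1.not_ge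
  · exact (hKw z hz).trans_lt h1

lemma next (h : IsCycleLevel K q E V) (hK : ∀ x, K x ≠ ⊤) (hsym : ∀ x y, q x y = q y x) :
    IsCycleLevel K q (EnextAux E V) (VnextAux E V) where
  nonempty _ := h.EnextAux_nonempty
  cover := h.EnextAux_cover
  eq_of_mem _ hA _ hB _ := h.EnextAux_eq_of_mem hA hB
  cost _ hA _ hB := h.VnextAux_eq hK hsym hA hB
  lt_boundary A hA := by
    rcases hA with hA | ⟨hA, -⟩
    · exact .inr fun x hx y hy hxy z hz => h.lt_of_mem_DstarAux hK hsym hA hx hy hxy hz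
    · exact h.lt_boundary A hA

lemma saddle_compl_eq (h : IsCycleLevel K q E V) (hA : A ∈ E) {a b : X} (ha : a ∈ A)
    (hb : b ∈ extBoundary q A) (hbmin : ∀ y ∈ extBoundary q A, K b ≤ K y) :
    saddle K q A Aᶜ = max (K a) (K b) := by
  apply le_antisymm
  · obtain ⟨hbA, x, hx, hxb⟩ := hb
    refine (saddle_le hx hbA hxb).trans ?_
    rcases h.lt_boundary A hA with ⟨z, rfl⟩ | hlt
    · rw [Set.mem_singleton_iff] at hx ha
      rw [hx, ha]
    · exact max_le ((hlt x hx b hbA hxb x hx).le.trans (le_max_right _ _)) (le_max_right _ _)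
  · refine max_le (h.le_saddle_compl hA ha) (le_saddle_iff.2 fun x hx y hy hxy => ?_)
    exact (hbmin y ⟨hy, x, hx, hxy⟩).trans (le_max_right _ _)

end IsCycleLevel

lemma max_ofReal_sub_tsub {m a : ℝ} (hma : m ≤ a) (b : ℝ) :
    max (ENNReal.ofReal (a - m)) (ENNReal.ofReal (b - m)) - ENNReal.ofReal (a - m) =
      ENNReal.ofReal (b - a) := by
  rcases le_total a b with hab | hab
  · rw [max_eq_right (ENNReal.ofReal_le_ofReal (sub_le_sub_right hab m)),
      ← ENNReal.ofReal_sub _ (sub_nonneg.2 hma), sub_sub_sub_cancel_right]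
  · rw [max_eq_left (ENNReal.ofReal_le_ofReal (sub_le_sub_right hab m)), tsub_self,
      ENNReal.ofReal_of_nonpos (sub_nonpos.2 hab)]

lemma isCycleLevel_singletons (H : X → ℝ) (q : X → X → ℝ) (m : ℝ) (hm : ∀ x, m ≤ H x) :
    IsCycleLevel (fun x => ENNReal.ofReal (H x - m)) q {A | ∃ i, A = {i}} (V0 H q) where
  nonempty := by rintro _ ⟨i, rfl⟩; simp
  cover x := ⟨{x}, ⟨x, rfl⟩, rfl⟩
  eq_of_mem := by
    rintro _ ⟨i, rfl⟩ _ ⟨j, rfl⟩ x hx hx'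
    rw [← Set.mem_singleton_iff.1 hx, ← Set.mem_singleton_iff.1 hx']
  cost := by
    rintro _ ⟨i, rfl⟩ _ ⟨j, rfl⟩ -
    by_cases hij : 0 < q i j
    · simp [V0, saddle, bottom, hij, max_ofReal_sub_tsub (hm i)]
    · simp [V0, saddle, bottom, hij]
  lt_boundary A hA := .inl hA

lemma isCycleLevel_cyc (H : X → ℝ) {q : X → X → ℝ} (hsym : ∀ x y, q x y = q y x) (m : ℝ)
    (hm : ∀ x, m ≤ H x) (k : ℕ) :
    IsCycleLevel (fun x => ENNReal.ofReal (H x - m)) q (Ecyc H q k) (Vcyc H q k) := by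
  induction k with
  | zero => exact isCycleLevel_singletons H q m hm
  | succ k ih => exact ih.next (fun _ => ENNReal.ofReal_ne_top) hsym

lemma extBoundary_nonempty {q : X → X → ℝ} {A : Set X} {x y : X} (hx : x ∈ A) (hy : y ∉ A)
    (h : JoinedIn q Set.univ x y) : (extBoundary q A).Nonempty := by
  obtain ⟨l, h1, h2, h3, -⟩ := h
  induction l generalizing x with
  | nil => simp at h1
  | cons z l ih =>
    obtain rfl : z = x := by simpa using h1
    cases l with
    | nil =>
      obtain rfl : z = y := by simpa using h2
      exact absurd hx hy
    | cons u l =>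
      have h3' := List.isChain_cons_cons.1 h3
      by_cases hu : u ∈ A
      · exact ih hu rfl (by simpa using h2) h3'.2
      · exact ⟨u, hu, z, hx, h3'.1⟩

lemma exists_sInf_image_eq [Finite X] (H : X → ℝ) {A : Set X} (hA : A.Nonempty) :
    ∃ a ∈ A, sInf (H '' A) = H a ∧ ∀ x ∈ A, H a ≤ H x := by
  obtain ⟨a, ha, hmin⟩ := Set.exists_min_image A H A.toFinite hA
  exact ⟨a, ha, IsLeast.csInf_eq ⟨⟨a, ha, rfl⟩, by rintro _ ⟨x, hx, rfl⟩; exact hmin x hx⟩, hmin⟩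

end

/-- For every graph cycle `A ≠ S`, `H_e(A) = max(min_{∂A} H - min_A H, 0)`; in particular if
`A` is a non-trivial path cycle then `H_e(A) = min_{∂A} H - min_A H`. -/
theorem HeC_eq (H : S → ℝ) (q : S → S → ℝ)
    (hq : ∀ x y : S, 0 ≤ q x y ∧ q x y ≤ 1)
    (hsum : ∀ x : S, ∑ y ∈ Finset.univ.erase x, q x y ≤ 1)
    (hsym : ∀ x y : S, q x y = q y x)
    (hirr : ∀ x y : S, JoinedIn q Set.univ x y)
    (A : Set S) (hA : A ∈ GraphCycles H q) (hAS : A ≠ Set.univ) :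
    HeC H q A = ENNReal.ofReal (sInf (H '' extBoundary q A) - sInf (H '' A)) ∧
      (IsNontrivialPathCycle H q A →
        (HeC H q A).toReal = sInf (H '' extBoundary q A) - sInf (H '' A)) := by
  have hkey : ∃ a ∈ A, ∃ b ∈ extBoundary q A, sInf (H '' A) = H a ∧
      sInf (H '' extBoundary q A) = H b ∧ HeC H q A = ENNReal.ofReal (H b - H a) := by
    obtain ⟨k₀, hk₀⟩ := hA
    obtain ⟨m, hm⟩ := (Set.finite_range H).bddBelow
    have hlevel := isCycleLevel_cyc H hsym m fun x => hm ⟨x, rfl⟩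
    have hne := (hlevel k₀).nonempty A hk₀
    obtain ⟨y, hy⟩ := (Set.ne_univ_iff_exists_notMem A).1 hAS
    obtain ⟨a, ha, hinf, hmin⟩ := exists_sInf_image_eq H hne
    obtain ⟨b, hb, hinf', hmin'⟩ :=
      exists_sInf_image_eq H (extBoundary_nonempty ha hy (hirr a y))
    refine ⟨a, ha, b, hb, hinf, hinf', ?_⟩
    have hHek : ∀ k, A ∈ Ecyc H q k → Hek H q k A = ENNReal.ofReal (H b - H a) := by
      intro k hk
      have hbot : bottom (fun x => ENNReal.ofReal (H x - m)) A = ENNReal.ofReal (H a - m) :=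
        le_antisymm (bottom_le ha) (le_iInf₂ fun x hx =>
          ENNReal.ofReal_le_ofReal (sub_le_sub_right (hmin x hx) m))
      rw [Hek, (hlevel k).HeAux_eq (fun _ => ENNReal.ofReal_ne_top) hk,
        (hlevel k).saddle_compl_eq hk ha hb fun y hy =>
            ENNReal.ofReal_le_ofReal (sub_le_sub_right (hmin' y hy) m), hbot,
        max_ofReal_sub_tsub (hm ⟨a, rfl⟩)]
    rw [HeC]
    refine le_antisymm (iSup₂_le fun k hk => (hHek k hk).le) ?_
    rw [← hHek k₀ hk₀]
    exact le_iSup₂ (f := fun k (_ : A ∈ Ecyc H q k) => Hek H q k A) k₀ hk₀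
  obtain ⟨a, ha, b, hb, hinf, hinf', heq⟩ := hkey
  rw [hinf, hinf', heq]
  exact ⟨rfl, fun hcyc => ENNReal.toReal_ofReal (sub_nonneg.2 (hcyc.2.2 a ha b hb).le)⟩

end MetropolisCycles
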